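/- Let k be an even positive integer, set m = 3k, and let a be a nonzero element of F_{2^m}. If the Kloosterman sum K_{2^m}(u) = 0 for every element u in the coset a F_{2^k}^* = {a z : z ∈ F_{2^k}^*}, then a^{3(2^k - 1)} = 1. -/

import Mathlib

/-- Absolute trace `T_{2^m}(a) = Σ_{0 ≤ i < m} a^(2^i)` (an element of `F_2 ⊆ F`). -/
def absTrace {F : Type*} [Field F] (m : ℕ) (a : F) : F :=
  ∑ i ∈ Finset.range m, a ^ (2 ^ i)

/-- Subtrace `S_{2^m}(a) = Σ_{0 ≤ i < j < m} a^(2^i + 2^j)` (an element of `F_2 ⊆ F`). -/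
def subTrace {F : Type*} [Field F] (m : ℕ) (a : F) : F :=
  ∑ i ∈ Finset.range m, ∑ j ∈ Finset.Ico (i + 1) m, a ^ (2 ^ i + 2 ^ j)

/-- `(-1)^u` for `u ∈ F_2 = {0, 1} ⊆ F`, as an integer. -/
def sgn {F : Type*} [Field F] [DecidableEq F] (u : F) : ℤ :=
  if u = 0 then 1 else -1

/-- The Kloosterman sum `K_{2^m}(a) = 1 + Σ_{x ∈ F^*} (-1)^{Tr^m_1(1/x + a x)}`. -/
def kloosterman {F : Type*} [Field F] [Fintype F] [DecidableEq F] (m : ℕ) (a : F) : ℤ :=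
  1 + ∑ x ∈ Finset.univ.filter (fun x : F => x ≠ 0), sgn (absTrace m (x⁻¹ + a * x))

/-- The absolute trace is additive in characteristic two. -/
lemma absTrace_add {F : Type*} [Field F] [CharP F 2] (m : ℕ) (x y : F) :
    absTrace m (x + y) = absTrace m x + absTrace m y := by
  simp only [absTrace, ← Finset.sum_add_distrib]
  exact Finset.sum_congr rfl fun i _ => add_pow_char_pow x y 2 i

lemma absTrace_zero {F : Type*} [Field F] (m : ℕ) : absTrace m (0 : F) = 0 := by
  simp [absTrace]

/-- Telescoping. -/
lemma absTrace_sq {F : Type*} [Field F] [CharP F 2] (m : ℕ) (x : F) (hx : x ^ 2 ^ m = x) :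
    absTrace m (x ^ 2) = absTrace m x := by
  have h1 : absTrace m (x ^ 2) = ∑ i ∈ Finset.range m, x ^ 2 ^ (i + 1) := by
    refine Finset.sum_congr rfl fun i _ => ?_
    rw [← pow_mul, pow_succ']
  have h2 := Finset.sum_range_succ' (fun i => x ^ 2 ^ i) m
  rw [Finset.sum_range_succ] at h2
  rw [h1]
  simp only [hx, pow_zero, pow_one] at h2
  exact (add_right_cancel h2).symm

lemma absTrace_artin {F : Type*} [Field F] [CharP F 2] (m : ℕ) (x : F) (hx : x ^ 2 ^ m = x) :
    absTrace m (x ^ 2 + x) = 0 := by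
  rw [absTrace_add, absTrace_sq m x hx, CharTwo.add_self_eq_zero]

/-- The trace polynomial has few roots. -/
lemma card_trace_zero {F : Type*} [Field F] [DecidableEq F] (m : ℕ) (hm : 0 < m) (c : F)
    (hc : c ≠ 0) (s : Finset F) (hs : ∀ z ∈ s, absTrace m (c * z) = 0) :
    s.card ≤ 2 ^ (m - 1) := by
  classical
  let p : Polynomial F := ∑ i ∈ Finset.range m, Polynomial.C (c ^ 2 ^ i) * Polynomial.X ^ 2 ^ i
  have hp1 : p.coeff (2 ^ 0) = c := by
    simp only [p, Polynomial.finsetSum_coeff, Polynomial.coeff_C_mul_X_pow]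
    rw [Finset.sum_eq_single 0]
    · simp
    · intro i _ hi
      rw [if_neg]
      intro h
      exact hi (Nat.pow_right_injective le_rfl h).symm
    · intro h
      exact absurd (Finset.mem_range.2 hm) h
  have hp : p ≠ 0 := by
    intro h
    rw [h] at hp1
    exact hc (by simpa using hp1.symm)
  have hdeg : p.natDegree ≤ 2 ^ (m - 1) := by
    refine Polynomial.natDegree_sum_le_of_forall_le _ _ fun i hi => ?_
    refine (Polynomial.natDegree_C_mul_X_pow_le _ _).trans ?_
    have := Finset.mem_range.1 hi
    exact Nat.pow_le_pow_right (by norm_num) (by omega)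
  have hsub : s ⊆ p.roots.toFinset := by
    intro z hz
    rw [Multiset.mem_toFinset, Polynomial.mem_roots hp, Polynomial.IsRoot.def]
    have := hs z hz
    simp only [p, Polynomial.eval_finsetSum, Polynomial.eval_mul, Polynomial.eval_C,
      Polynomial.eval_pow, Polynomial.eval_X]
    simpa [absTrace, mul_pow] using this
  calc s.card ≤ p.roots.toFinset.card := Finset.card_le_card hsub
    _ ≤ Multiset.card p.roots := Multiset.toFinset_card_le _
    _ ≤ p.natDegree := Polynomial.card_roots' p
    _ ≤ _ := hdeg

/-- Number of solutions of the Artin-Schreier equation. -/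
lemma artin_count {F : Type*} [Field F] [Fintype F] [DecidableEq F] [CharP F 2] (m : ℕ)
    (hm : 0 < m) (hcard : Fintype.card F = 2 ^ m) (e : F) :
    ((Finset.univ.filter (fun s : F => s ^ 2 + s = e)).card : ℤ) = 1 + sgn (absTrace m e) := by
  have h2 : (2 : F) = 0 := CharTwo.two_eq_zero
  have hfix : ∀ x : F, x ^ 2 ^ m = x := fun x => by rw [← hcard]; exact FiniteField.pow_card x
  let f : F → F := fun s => s ^ 2 + s
  have hfib : ∀ s t : F, f s = f t ↔ t = s ∨ t = s + 1 := by
    intro s t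
    have : f s = f t ↔ (t - s) * (t - (s + 1)) = 0 := by
      simp only [f]
      constructor
      · intro h
        linear_combination -h + (s ^ 2 - t * s + s - t) * h2
      · intro h
        linear_combination -h + (s ^ 2 - t * s + s - t) * h2
    rw [this, mul_eq_zero, sub_eq_zero, sub_eq_zero]
  have hfibcard : ∀ s : F, (Finset.univ.filter (fun t : F => f t = f s)).card = 2 := by
    intro s
    have : Finset.univ.filter (fun t : F => f t = f s) = {s, s + 1} := by
      ext t
      simp only [Finset.mem_filter, Finset.mem_univ, true_and, Finset.mem_insert,
        Finset.mem_singleton]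
      rw [eq_comm, hfib]
    rw [this, Finset.card_pair]
    simp
  have himg : 2 ^ m ≤ 2 * (Finset.univ.image f).card := by
    rw [← hcard, ← Finset.card_univ]
    refine Finset.card_le_mul_card_image _ _ ?_
    intro a ha
    obtain ⟨s, -, rfl⟩ := Finset.mem_image.1 ha
    exact (hfibcard s).le
  have hker : (Finset.univ.filter (fun z : F => absTrace m z = 0)).card ≤ 2 ^ (m - 1) := by
    refine card_trace_zero m hm 1 one_ne_zero _ ?_
    intro z hz
    simpa using hz
  have hsub : Finset.univ.image f ⊆ Finset.univ.filter (fun z : F => absTrace m z = 0) := by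
    intro z hz
    obtain ⟨s, -, rfl⟩ := Finset.mem_image.1 hz
    simpa using absTrace_artin m s (hfix s)
  have heq := Finset.eq_of_subset_of_card_le hsub (by
    have : 2 ^ m = 2 * 2 ^ (m - 1) := by rw [← pow_succ']; congr 1; omega
    omega)
  by_cases he : absTrace m e = 0
  · have : e ∈ Finset.univ.image f := by rw [heq]; simpa using he
    obtain ⟨s, -, rfl⟩ := Finset.mem_image.1 this
    have h := hfibcard s
    simp only [f] at h he ⊢
    rw [h, sgn, if_pos he]
    norm_num
  · have : Finset.univ.filter (fun s : F => s ^ 2 + s = e) = ∅ := by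
      refine Finset.filter_eq_empty_iff.2 ?_
      rintro s - rfl
      exact he (absTrace_artin m s (hfix s))
    rw [this, sgn, if_neg he]
    norm_num

/-- A finite abelian 2-group of order at least 16 with a single involution has an element of
order 16. -/
lemma exists_order_sixteen {G : Type*} [AddCommGroup G] [Fintype G] [DecidableEq G] (m : ℕ)
    (hm : 4 ≤ m) (hcard : Fintype.card G = 2 ^ m) (t : G)
    (ht : ∀ P : G, 2 • P = 0 → P = 0 ∨ P = t) : ∃ P : G, 8 • P ≠ 0 ∧ 16 • P = 0 := by
  have step : ∀ s : Finset G, s.card ≤ 2 * (s.image (fun P => 2 • P)).card := by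
    intro s
    refine Finset.card_le_mul_card_image _ _ ?_
    intro a ha
    obtain ⟨P, -, rfl⟩ := Finset.mem_image.1 ha
    refine (Finset.card_le_card (t := {P, P + t}) ?_).trans Finset.card_le_two
    intro Q hQ
    have hQ := (Finset.mem_filter.1 hQ).2
    simp only [Finset.mem_insert, Finset.mem_singleton]
    rcases ht (Q - P) (by rw [smul_sub, hQ, sub_self]) with h | h
    · left; exact sub_eq_zero.1 h
    · right; rw [← h]; abel
  have hex : ∃ P : G, 8 • P ≠ 0 := by
    by_contra! hall
    have h1 := step Finset.univ
    have h2 := step (Finset.univ.image (fun P => 2 • P))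
    have h3 := step ((Finset.univ.image (fun P => 2 • P)).image (fun P => 2 • P))
    have h4 : (((Finset.univ.image (fun P : G => 2 • P)).image (fun P => 2 • P)).image
        (fun P => 2 • P)).card ≤ 1 := by
      rw [Finset.card_le_one_iff_subset_singleton]
      refine ⟨0, ?_⟩
      intro Q hQ
      simp only [Finset.mem_image, Finset.mem_univ, true_and, exists_exists_eq_and] at hQ
      obtain ⟨P, rfl⟩ := hQ
      have := hall P
      simpa [smul_smul] using this
    rw [Finset.card_univ, hcard] at h1
    have : 2 ^ 4 ≤ 2 ^ m := Nat.pow_le_pow_right (by norm_num) hm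
    omega
  obtain ⟨P, hP⟩ := hex
  have hd : addOrderOf P ∣ 2 ^ m := hcard ▸ addOrderOf_dvd_card
  obtain ⟨j, -, hj⟩ := (Nat.dvd_prime_pow Nat.prime_two).1 hd
  have hj4 : 4 ≤ j := by
    by_contra hlt
    apply hP
    rw [← addOrderOf_dvd_iff_nsmul_eq_zero, hj]
    exact pow_dvd_pow 2 (show j ≤ 3 by omega)
  refine ⟨2 ^ (j - 4) • P, ?_, ?_⟩
  · rw [smul_smul, ne_eq, ← addOrderOf_dvd_iff_nsmul_eq_zero, hj]
    have : 8 * 2 ^ (j - 4) = 2 ^ (j - 1) := by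
      rw [show j - 1 = 3 + (j - 4) by omega, pow_add]; norm_num
    rw [this, Nat.pow_dvd_pow_iff_le_right (by norm_num)]
    omega
  · rw [smul_smul, ← addOrderOf_dvd_iff_nsmul_eq_zero, hj]
    have : 16 * 2 ^ (j - 4) = 2 ^ j := by
      conv_rhs => rw [show j = 4 + (j - 4) by omega, pow_add]
      norm_num
    rw [this]

/-- Counting affine points on `y² + xy = x³ + b²`. -/
lemma affine_count {F : Type*} [Field F] [Fintype F] [DecidableEq F] [CharP F 2] (m : ℕ)
    (hm : 0 < m) (hcard : Fintype.card F = 2 ^ m) (b : F) :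
    ((Finset.univ.filter
      (fun p : F × F => p.2 ^ 2 + p.1 * p.2 = p.1 ^ 3 + b ^ 2)).card : ℤ)
      = 2 ^ m - 1 + kloosterman m b := by
  have h2 : (2 : F) = 0 := CharTwo.two_eq_zero
  have hfix : ∀ x : F, x ^ 2 ^ m = x := fun x => by rw [← hcard]; exact FiniteField.pow_card x
  have hcount : ((Finset.univ.filter
      (fun p : F × F => p.2 ^ 2 + p.1 * p.2 = p.1 ^ 3 + b ^ 2)).card : ℤ)
      = ∑ x : F, ((Finset.univ.filter
        (fun y : F => y ^ 2 + x * y = x ^ 3 + b ^ 2)).card : ℤ) := by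
    rw [Finset.card_filter, Fintype.sum_prod_type]
    simp only [Finset.card_filter]
    push_cast
    rfl
  have hzero : ((Finset.univ.filter
        (fun y : F => y ^ 2 + 0 * y = 0 ^ 3 + b ^ 2)).card : ℤ) = 1 := by
    have : Finset.univ.filter (fun y : F => y ^ 2 + 0 * y = 0 ^ 3 + b ^ 2) = {b} := by
      ext y
      simp only [Finset.mem_filter, Finset.mem_univ, true_and, Finset.mem_singleton]
      constructor
      · intro h
        have : (y - b) ^ 2 = 0 := by linear_combination h + (b ^ 2 - y * b) * h2
        exact sub_eq_zero.1 (pow_eq_zero_iff (two_ne_zero) |>.1 this)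
      · rintro rfl; ring
    rw [this]; simp
  have hne : ∀ x : F, x ≠ 0 → ((Finset.univ.filter
        (fun y : F => y ^ 2 + x * y = x ^ 3 + b ^ 2)).card : ℤ)
        = 1 + sgn (absTrace m (x + b * x⁻¹)) := by
    intro x hx
    have htr : absTrace m (x + b * x⁻¹) = absTrace m (x + (b * x⁻¹) ^ 2) := by
      rw [absTrace_add, absTrace_add, absTrace_sq m _ (hfix _)]
    rw [htr, ← artin_count m hm hcard]
    congr 1
    refine Finset.card_nbij' (fun y => y * x⁻¹) (fun s => s * x) ?_ ?_ ?_ ?_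
    · intro y hy
      simp only [Finset.coe_filter, Finset.mem_univ, true_and, Set.mem_ofPred_eq] at hy ⊢
      field_simp
      linear_combination hy
    · intro s hs
      simp only [Finset.coe_filter, Finset.mem_univ, true_and, Set.mem_ofPred_eq] at hs ⊢
      field_simp at hs
      linear_combination hs
    · intro y _
      simp [hx]
    · intro y _
      simp [hx]
  have hsplit : (Finset.univ : Finset F) =
      insert 0 (Finset.univ.filter (fun x : F => x ≠ 0)) := by
    ext x; by_cases h : x = 0 <;> simp [h]
  have hcard0 : ((Finset.univ.filter (fun x : F => x ≠ 0)).card : ℤ) = 2 ^ m - 1 := by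
    have h := congrArg Finset.card hsplit
    rw [Finset.card_insert_of_notMem (by simp), Finset.card_univ, hcard] at h
    have h' : ((2 ^ m : ℕ) : ℤ) = _ := congrArg Nat.cast h
    push_cast at h'
    linarith
  rw [hcount, congrArg (fun S : Finset F => ∑ x ∈ S, ((Finset.univ.filter
        (fun y : F => y ^ 2 + x * y = x ^ 3 + b ^ 2)).card : ℤ)) hsplit]
  rw [Finset.sum_insert (by simp), hzero, Finset.sum_congr rfl
    (fun x hx => hne x (Finset.mem_filter.1 hx).2), Finset.sum_add_distrib, Finset.sum_const,
    nsmul_eq_mul, hcard0, kloosterman]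
  have hinv : ∑ x ∈ Finset.univ.filter (fun x : F => x ≠ 0), sgn (absTrace m (x + b * x⁻¹))
      = ∑ x ∈ Finset.univ.filter (fun x : F => x ≠ 0), sgn (absTrace m (x⁻¹ + b * x)) := by
    refine Finset.sum_nbij' (fun x => x⁻¹) (fun x => x⁻¹) ?_ ?_ ?_ ?_ ?_ <;> simp
  rw [hinv]
  ring

/-- The curve `y² + xy = x³ + b²`. -/
def curveE {F : Type*} [Field F] (b : F) : WeierstrassCurve.Affine F :=
  { a₁ := 1, a₂ := 0, a₃ := 0, a₄ := 0, a₆ := b ^ 2 }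

lemma curveE_equation {F : Type*} [Field F] (b x y : F) :
    (curveE b).Equation x y ↔ y ^ 2 + x * y = x ^ 3 + b ^ 2 := by
  rw [WeierstrassCurve.Affine.equation_iff]
  simp [curveE]

lemma curveE_nonsingular {F : Type*} [Field F] [CharP F 2] (b x y : F) (hb : b ≠ 0) :
    (curveE b).Nonsingular x y ↔ y ^ 2 + x * y = x ^ 3 + b ^ 2 := by
  rw [WeierstrassCurve.Affine.nonsingular_iff', curveE_equation]
  have h2 : (2 : F) = 0 := CharTwo.two_eq_zero
  refine ⟨fun h => h.1, fun h => ⟨h, ?_⟩⟩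
  by_cases hx : x = 0
  · left
    subst hx
    simp only [curveE]
    intro h0
    have hy : y = 0 := by linear_combination h0
    subst hy
    apply hb
    have : b ^ 2 = 0 := by linear_combination -h
    exact pow_eq_zero_iff two_ne_zero |>.1 this
  · right
    simpa [curveE, h2] using hx

lemma curveE_double_zero {F : Type*} [Field F] [DecidableEq F] [CharP F 2] (b y : F)
    (h : (curveE b).Nonsingular 0 y) :
    2 • (WeierstrassCurve.Affine.Point.some 0 y h) = 0 := by
  have h2 : (2 : F) = 0 := CharTwo.two_eq_zero
  rw [two_nsmul]
  apply WeierstrassCurve.Affine.Point.add_self_of_Y_eq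
  simp only [WeierstrassCurve.Affine.negY, curveE]
  linear_combination y * h2

lemma curveE_double {F : Type*} [Field F] [DecidableEq F] [CharP F 2] (b x y : F) (hx : x ≠ 0)
    (h : (curveE b).Nonsingular x y) :
    ∃ l y' h', 2 • (WeierstrassCurve.Affine.Point.some x y h) =
      WeierstrassCurve.Affine.Point.some (W' := curveE b) (l ^ 2 + l) y' h' ∧
      l ^ 2 + l = x ^ 2 + b ^ 2 / x ^ 2 := by
  have h2 : (2 : F) = 0 := CharTwo.two_eq_zero
  have heq := (curveE_equation b x y).1 h.1
  have hy : y ≠ (curveE b).negY x y := by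
    simp only [WeierstrassCurve.Affine.negY, curveE]
    intro h0
    apply hx
    linear_combination -h0 + (y + x) * h2
  have hl : (curveE b).slope x x y y = x + y / x := by
    rw [WeierstrassCurve.Affine.slope_of_Y_ne rfl hy]
    simp only [WeierstrassCurve.Affine.negY, curveE]
    have : y - (-y - 1 * x - 0) = x := by linear_combination y * h2
    rw [this]
    field_simp
    linear_combination (x ^ 2 - y) * h2
  have hX : (curveE b).addX x x ((curveE b).slope x x y y) = (x + y / x) ^ 2 + (x + y / x) := by
    rw [hl]
    simp only [WeierstrassCurve.Affine.addX, curveE]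
    linear_combination -x * h2
  have key : ∀ X Y : F, ∀ hn : (curveE b).Nonsingular X Y, ∀ X', X = X' → ∃ h',
      WeierstrassCurve.Affine.Point.some X Y hn =
        WeierstrassCurve.Affine.Point.some (W' := curveE b) X' Y h' := by
    rintro X Y hn X' rfl
    exact ⟨hn, rfl⟩
  rw [two_nsmul, WeierstrassCurve.Affine.Point.add_self_of_Y_ne hy]
  obtain ⟨h', e⟩ := key _ _ (WeierstrassCurve.Affine.nonsingular_add h h
    fun hxy => hy hxy.right) _ hX
  refine ⟨x + y / x, _, h', e, ?_⟩
  field_simp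
  linear_combination heq + (y * x ^ 2 + x ^ 3) * h2

/-- A vanishing Kloosterman sum yields a point of order 16, and so trace conditions. -/
lemma kloosterman_zero {F : Type*} [Field F] [Fintype F] [DecidableEq F] [CharP F 2] (m : ℕ)
    (hm : 4 ≤ m) (hcard : Fintype.card F = 2 ^ m) (b : F) (hb : b ≠ 0)
    (hK : kloosterman m b = 0) :
    ∃ w : F, (w ^ 2 + w) ^ 4 = b ∧ absTrace m ((w ^ 2 + w) * w) = 0 := by
  have h2 : (2 : F) = 0 := CharTwo.two_eq_zero
  have hfix : ∀ x : F, x ^ 2 ^ m = x := fun x => by rw [← hcard]; exact FiniteField.pow_card x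
  have hsq : ∀ x y : F, x ^ 2 = y ^ 2 → x = y := by
    intro x y h
    have : (x - y) ^ 2 = 0 := by linear_combination h + (y ^ 2 - x * y) * h2
    exact sub_eq_zero.1 (pow_eq_zero_iff (two_ne_zero) |>.1 this)
  classical
  let e : (curveE b).Point ≃ Option {p : F × F // p.2 ^ 2 + p.1 * p.2 = p.1 ^ 3 + b ^ 2} :=
    (WeierstrassCurve.Affine.nonsingularPointEquiv (curveE b)).trans
      (Equiv.optionCongr (Equiv.subtypeEquivRight fun p => curveE_nonsingular b p.1 p.2 hb))
  let _ : Fintype (curveE b).Point := Fintype.ofEquiv _ e.symm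
  have hc : Fintype.card (curveE b).Point = 2 ^ m := by
    rw [Fintype.card_congr e, Fintype.card_option, Fintype.card_subtype]
    have := affine_count m (by omega) hcard b
    rw [hK] at this
    zify
    rw [this]
    ring
  have hns : (curveE b).Nonsingular 0 b := by
    rw [curveE_nonsingular b _ _ hb]; ring
  obtain ⟨P, hP8, hP16⟩ := exists_order_sixteen m hm hc (.some 0 b hns) (by
    intro P hP
    rcases P with _ | ⟨x, y, h⟩
    · left; rfl
    · right
      by_cases hx : x = 0
      · subst hx
        have := (curveE_nonsingular b _ _ hb).1 h
        have hy : y = b := hsq _ _ (by linear_combination this)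
        subst hy
        rfl
      · obtain ⟨l, y', h', e, -⟩ := curveE_double b x y hx h
        rw [e] at hP
        exact absurd hP (WeierstrassCurve.Affine.Point.some_ne_zero _))
  have step : ∀ x y, ∀ h : (curveE b).Nonsingular x y,
      2 • (WeierstrassCurve.Affine.Point.some x y h) ≠ 0 → x ≠ 0 := by
    rintro x y h hne rfl
    exact hne (curveE_double_zero b y h)
  have e4 : 4 • P = 2 • (2 • P) := by rw [smul_smul]; norm_num
  have e8 : 8 • P = 2 • (4 • P) := by rw [smul_smul]; norm_num
  have e16 : 16 • P = 2 • (8 • P) := by rw [smul_smul]; norm_num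
  have hP4 : 4 • P ≠ 0 := fun h => hP8 (by rw [e8, h, smul_zero])
  have hP2 : 2 • P ≠ 0 := fun h => hP4 (by rw [e4, h, smul_zero])
  rcases P with _ | ⟨x₀, y₀, h₀⟩
  · exact absurd (smul_zero 8) hP8
  have hx₀ := step _ _ _ hP2
  obtain ⟨l₁, y₁, h₁, E₁, -⟩ := curveE_double b x₀ y₀ hx₀ h₀
  rw [E₁] at e4
  rw [e4] at hP4
  have hx₁ := step _ _ _ hP4
  obtain ⟨l₂, y₂, h₂', E₂, F₂⟩ := curveE_double b _ y₁ hx₁ h₁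
  rw [e4, E₂] at e8
  rw [e8] at hP8
  have hx₂ := step _ _ _ hP8
  obtain ⟨l₃, y₃, h₃, E₃, F₃⟩ := curveE_double b _ y₂ hx₂ h₂'
  rw [e8, E₃] at e16
  rw [e16] at hP16
  have hx₃ : l₃ ^ 2 + l₃ = 0 := by
    by_contra hne
    obtain ⟨l, y', h', e, -⟩ := curveE_double b _ y₃ hne h₃
    rw [e] at hP16
    exact WeierstrassCurve.Affine.Point.some_ne_zero _ hP16
  have t₁ : absTrace m (l₁ ^ 2 + l₁) = 0 := absTrace_artin m l₁ (hfix _)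
  have t₂ : absTrace m (l₂ ^ 2 + l₂) = 0 := absTrace_artin m l₂ (hfix _)
  generalize l₁ ^ 2 + l₁ = x at *
  generalize l₂ ^ 2 + l₂ = c at *
  rw [hx₃] at F₃
  have hcb : c ^ 2 = b := by
    apply hsq
    field_simp at F₃
    linear_combination -F₃ - b ^ 2 * h2
  -- the square root of `c`
  have hd : (x + b / x) ^ 2 = c := by
    rw [F₂]
    linear_combination (x * (b / x)) * h2
  set d := x + b / x with hd'
  have hd0 : d ≠ 0 := by
    intro h
    apply hx₂
    rw [← hd, h]; ring
  have hdb : d ^ 4 = b := by rw [← hcb, ← hd]; ring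
  have hq : x ^ 2 + d * x + d ^ 4 = 0 := by
    rw [hdb, hd']
    field_simp
    linear_combination (x ^ 2 + b) * h2
  have hw : (x / d + d) ^ 2 + (x / d + d) = d := by
    field_simp
    linear_combination hq + (x * d ^ 2) * h2
  refine ⟨x / d + d, ?_, ?_⟩
  · rw [hw, hdb]
  · rw [hw, mul_add, mul_div_cancel₀ _ hd0, ← sq, absTrace_add, t₁, hd, t₂, add_zero]

lemma subfield_card {F : Type*} [Field F] [Fintype F] [DecidableEq F] (k : ℕ)
    (hcard : Fintype.card F = 2 ^ (3 * k)) :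
    2 ^ k ≤ (Finset.univ.filter (fun z : F => z ^ 2 ^ k = z)).card := by
  have hq : 1 ≤ 2 ^ k := Nat.one_le_two_pow
  have hker := IsCyclic.card_powMonoidHom_ker (G := Fˣ) (2 ^ k - 1)
  have hdvd : 2 ^ k - 1 ∣ Nat.card Fˣ := by
    rw [Nat.card_eq_fintype_card, Fintype.card_units, hcard, mul_comm, pow_mul]
    exact Nat.sub_one_dvd_pow_sub_one _ _
  rw [Nat.gcd_eq_right hdvd] at hker
  have hsub : insert 0 ((Finset.univ.filter
      (fun u : Fˣ => u ^ (2 ^ k - 1) = 1)).image (fun u : Fˣ => (u : F)))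
      ⊆ Finset.univ.filter (fun z : F => z ^ 2 ^ k = z) := by
    intro z hz
    simp only [Finset.mem_insert, Finset.mem_image, Finset.mem_filter, Finset.mem_univ,
      true_and] at hz ⊢
    rcases hz with rfl | ⟨u, hu, rfl⟩
    · simp
    · have h : u ^ 2 ^ k = u := by
        conv_lhs => rw [show 2 ^ k = 2 ^ k - 1 + 1 by omega]
        rw [pow_succ, hu, one_mul]
      exact_mod_cast congrArg Units.val h
  refine le_trans ?_ (Finset.card_le_card hsub)
  rw [Finset.card_insert_of_notMem (by simp), Finset.card_image_of_injective _ Units.val_injective]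
  have : (Finset.univ.filter (fun u : Fˣ => u ^ (2 ^ k - 1) = 1)).card = 2 ^ k - 1 := by
    rw [← Fintype.card_subtype, ← Nat.card_eq_fintype_card]
    exact hker
  omega

lemma absTrace_split {F : Type*} [Field F] [CharP F 2] (k : ℕ) (x : F) :
    absTrace (3 * k) x = absTrace k (x + x ^ 2 ^ k + (x ^ 2 ^ k) ^ 2 ^ k) := by
  rw [absTrace_add, absTrace_add, show 3 * k = k + k + k by ring, absTrace,
    Finset.sum_range_add, Finset.sum_range_add]
  simp only [absTrace]
  congr 1
  · congr 1
    refine Finset.sum_congr rfl fun i _ => ?_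
    rw [← pow_mul, ← pow_add]
  · refine Finset.sum_congr rfl fun i _ => ?_
    rw [← pow_mul, ← pow_mul, ← pow_add, ← pow_add, add_assoc]

/-- The key algebraic identity, relating the trace of `dw` with the second symmetric function. -/
lemma trace_e2 {F : Type*} [Field F] [CharP F 2] (k : ℕ)
    (hfix : ∀ x : F, ((x ^ 2 ^ k) ^ 2 ^ k) ^ 2 ^ k = x) (w d d1 d2 : F)
    (hd : w ^ 2 + w = d) (hd1 : d ^ 2 ^ k = d1) (hd2 : d1 ^ 2 ^ k = d2)
    (hsum : d + d1 + d2 = 0)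
    (hT : absTrace (3 * k) (d * w) = 0) :
    absTrace k (d * d1 + d * d2 + d1 * d2) = 0 := by
  have h2 : (2 : F) = 0 := CharTwo.two_eq_zero
  have hadd : ∀ x y : F, (x + y) ^ 2 ^ k = x ^ 2 ^ k + y ^ 2 ^ k := fun x y =>
    add_pow_char_pow x y 2 k
  have hsqc : ∀ x : F, (x ^ 2) ^ 2 ^ k = (x ^ 2 ^ k) ^ 2 := fun x => pow_right_comm x _ _
  have hTd : absTrace (3 * k) d = 0 := by
    rw [absTrace_split, hd1, hd2, hsum, absTrace_zero]
  -- normalise the relative trace of `w`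
  obtain ⟨w, hd, hT, hw⟩ : ∃ w : F, w ^ 2 + w = d ∧ absTrace (3 * k) (d * w) = 0 ∧
      w + w ^ 2 ^ k + (w ^ 2 ^ k) ^ 2 ^ k = 0 := by
    have e1 : (w ^ 2 ^ k) ^ 2 + w ^ 2 ^ k = d1 := by rw [← hsqc, ← hadd, hd, hd1]
    have e2 : ((w ^ 2 ^ k) ^ 2 ^ k) ^ 2 + (w ^ 2 ^ k) ^ 2 ^ k = d2 := by
      rw [← hsqc, ← hadd, e1, hd2]
    have hv : (w + w ^ 2 ^ k + (w ^ 2 ^ k) ^ 2 ^ k) * (w + w ^ 2 ^ k + (w ^ 2 ^ k) ^ 2 ^ k + 1)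
        = 0 := by
      linear_combination hd + e1 + e2 + hsum + (w * w ^ 2 ^ k + w * (w ^ 2 ^ k) ^ 2 ^ k +
        w ^ 2 ^ k * (w ^ 2 ^ k) ^ 2 ^ k) * h2
    rcases mul_eq_zero.1 hv with h | h
    · exact ⟨w, hd, hT, h⟩
    · refine ⟨w + 1, ?_, ?_, ?_⟩
      · linear_combination hd + (w + 1) * h2
      · rw [mul_add, absTrace_add, hT, mul_one, hTd, add_zero]
      · rw [hadd, hadd, one_pow, one_pow]
        linear_combination h + h2
  have e1 : (w ^ 2 ^ k) ^ 2 + w ^ 2 ^ k = d1 := by rw [← hsqc, ← hadd, hd, hd1]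
  have e2 : ((w ^ 2 ^ k) ^ 2 ^ k) ^ 2 + (w ^ 2 ^ k) ^ 2 ^ k = d2 := by
    rw [← hsqc, ← hadd, e1, hd2]
  rw [absTrace_split, mul_pow, mul_pow, hd1, hd2] at hT
  have e3 := hfix w
  set w1 := w ^ 2 ^ k with hw1
  set w2 := w1 ^ 2 ^ k with hw2
  obtain ⟨g, hg⟩ : ∃ g, g = w * w1 + w * w2 + w1 * w2 := ⟨_, rfl⟩
  have hgq : g ^ 2 ^ k = g := by
    rw [hg, hadd, hadd, mul_pow, mul_pow, mul_pow, ← hw1, ← hw2, e3]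
    ring
  have hw2' : w2 = w + w1 := by linear_combination hw - (w + w1) * h2
  have hid : d * d1 + d * d2 + d1 * d2 = (g ^ 2 + g) + (d * w + d1 * w1 + d2 * w2) := by
    rw [hg, ← hd, ← e1, ← e2, hw2']
    ring_nf
    grind
  rw [hid, absTrace_add, hT, absTrace_artin k g hgq, add_zero]

/-- For even `k > 0`, `m = 3k` and nonzero `a ∈ F_{2^m}`, if `K_{2^m}(a z) = 0` for every
nonzero `z` in the subfield `F_{2^k} = {z : z^(2^k) = z}`, then `a^(3(2^k - 1)) = 1`. -/
theorem stmt4 {F : Type*} [Field F] [Fintype F] [DecidableEq F] (k m : ℕ)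
    (heven : Even k) (hk : 0 < k) (hm : m = 3 * k)
    (hcard : Fintype.card F = 2 ^ m) (a : F) (ha : a ≠ 0)
    (hzero : ∀ z : F, z ^ (2 ^ k) = z → z ≠ 0 → kloosterman m (a * z) = 0) :
    a ^ (3 * (2 ^ k - 1)) = 1 := by
  subst hm
  have hchar : CharP F 2 := by
    obtain ⟨p, hp⟩ := CharP.exists F
    obtain ⟨n, hpp, hn⟩ := FiniteField.card F p
    have : p = 2 := by
      have h1 : p ∣ 2 ^ (3 * k) := by
        rw [← hcard, hn]
        exact dvd_pow_self p n.ne_zero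
      exact (Nat.prime_dvd_prime_iff_eq hpp Nat.prime_two).1 (hpp.dvd_of_dvd_pow h1)
    exact this ▸ hp
  have h2 : (2 : F) = 0 := CharTwo.two_eq_zero
  have hadd : ∀ x y : F, (x + y) ^ 2 ^ k = x ^ 2 ^ k + y ^ 2 ^ k := fun x y =>
    add_pow_char_pow x y 2 k
  have hadd4 : ∀ x y : F, (x + y) ^ 4 = x ^ 4 + y ^ 4 := fun x y =>
    add_pow_char_pow x y 2 2
  have hfixm : ∀ x : F, x ^ 2 ^ (3 * k) = x := fun x => by
    rw [← hcard]; exact FiniteField.pow_card x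
  have hfix : ∀ x : F, ((x ^ 2 ^ k) ^ 2 ^ k) ^ 2 ^ k = x := fun x => by
    rw [← pow_mul, ← pow_mul, ← pow_add, ← pow_add, show k + (k + k) = 3 * k by ring, hfixm]
  have hcomm : ∀ x : F, ∀ i : ℕ, (x ^ i) ^ 2 ^ k = (x ^ 2 ^ k) ^ i := fun x i =>
    pow_right_comm x _ _
  have hm4 : 4 ≤ 3 * k := by
    obtain ⟨r, hr⟩ := heven
    omega
  have main := fun z hz hz0 => kloosterman_zero (3 * k) hm4 hcard (a * z)
    (mul_ne_zero ha hz0) (hzero z hz hz0)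
  have nondeg : ∀ c : F, (∀ z : F, z ^ 2 ^ k = z → z ≠ 0 → absTrace k (c * z) = 0) → c = 0 := by
    intro c hc
    by_contra hc0
    have h := card_trace_zero k hk c hc0 (Finset.univ.filter (fun z : F => z ^ 2 ^ k = z)) (by
      intro z hz
      by_cases hz0 : z = 0
      · rw [hz0, mul_zero, absTrace_zero]
      · exact hc z (Finset.mem_filter.1 hz).2 hz0)
    have h' := (subfield_card k hcard).trans h
    rw [Nat.pow_le_pow_iff_right (by norm_num)] at h'
    omega
  obtain ⟨a1, ha1⟩ : ∃ a1, a ^ 2 ^ k = a1 := ⟨_, rfl⟩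
  obtain ⟨a2, ha2⟩ : ∃ a2, a1 ^ 2 ^ k = a2 := ⟨_, rfl⟩
  have ha3 : a2 ^ 2 ^ k = a := by rw [← ha2, ← ha1, hfix]
  -- the relative trace of `a` vanishes
  have hA : a + a1 + a2 = 0 := by
    apply nondeg
    intro z hz hz0
    obtain ⟨w, hw, -⟩ := main z hz hz0
    have h1 : absTrace (3 * k) (a * z) = 0 := by
      rw [← hw, show (w ^ 2 + w) ^ 4 = ((w ^ 2 + w) ^ 2) ^ 2 by ring,
        absTrace_sq _ _ (hfixm _), absTrace_sq _ _ (hfixm _), absTrace_artin _ _ (hfixm _)]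
    rw [absTrace_split, mul_pow, mul_pow, hz, hz, ha1, ha2] at h1
    rw [← h1]
    congr 1
    ring
  -- the second symmetric function of the conjugates of `a` vanishes
  have hB : a * a1 + a * a2 + a1 * a2 = 0 := by
    apply nondeg
    intro y hy hy0
    obtain ⟨z, hzy, hz⟩ : ∃ z : F, z ^ 2 = y ∧ z ^ 2 ^ k = z := by
      refine ⟨y ^ 2 ^ (k - 1), ?_, ?_⟩
      · rw [← pow_mul, ← pow_succ, show k - 1 + 1 = k by omega, hy]
      · rw [hcomm, hy]
    have hz0 : z ≠ 0 := by
      rintro rfl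
      apply hy0
      rw [← hzy]; ring
    obtain ⟨w, hw, hT⟩ := main z hz hz0
    obtain ⟨d, hd⟩ : ∃ d, w ^ 2 + w = d := ⟨_, rfl⟩
    rw [hd] at hw hT
    obtain ⟨d1, hd1⟩ : ∃ d1, d ^ 2 ^ k = d1 := ⟨_, rfl⟩
    obtain ⟨d2, hd2⟩ : ∃ d2, d1 ^ 2 ^ k = d2 := ⟨_, rfl⟩
    have hd3 : d2 ^ 2 ^ k = d := by rw [← hd2, ← hd1, hfix]
    have hw1 : d1 ^ 4 = a1 * z := by rw [← hd1, ← hcomm, hw, mul_pow, hz, ha1]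
    have hw2 : d2 ^ 4 = a2 * z := by rw [← hd2, ← hcomm, hw1, mul_pow, hz, ha2]
    have hsum : d + d1 + d2 = 0 := by
      have h4 : (d + d1 + d2) ^ 4 = 0 := by
        rw [hadd4, hadd4, hw, hw1, hw2, ← add_mul, ← add_mul, hA, zero_mul]
      exact pow_eq_zero_iff (by norm_num) |>.1 h4
    have he := trace_e2 k hfix w d d1 d2 hd hd1 hd2 hsum hT
    obtain ⟨e, hee⟩ : ∃ e, d * d1 + d * d2 + d1 * d2 = e := ⟨_, rfl⟩
    have heq : e ^ 2 ^ k = e := by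
      rw [← hee, hadd, hadd, mul_pow, mul_pow, mul_pow, hd1, hd2, hd3]
      ring
    have he4 : (a * a1 + a * a2 + a1 * a2) * y = (e ^ 2) ^ 2 := by
      have : (e ^ 2) ^ 2 = e ^ 4 := by ring
      rw [this, ← hee, hadd4, hadd4, mul_pow, mul_pow, mul_pow, hw, hw1, hw2, ← hzy]
      ring
    rw [he4, absTrace_sq _ _ (by rw [hcomm, heq]), absTrace_sq _ _ heq, ← hee, he]
  have hN : a ^ 3 = a * a1 * a2 := by
    linear_combination a ^ 2 * hA - a * hB
  have hNq : (a ^ 3) ^ 2 ^ k = a ^ 3 := by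
    rw [hN, mul_pow, mul_pow, ha1, ha2, ha3]
    ring
  have ha30 : a ^ 3 ≠ 0 := pow_ne_zero _ ha
  have hq : 1 ≤ 2 ^ k := Nat.one_le_two_pow
  rw [pow_mul]
  apply mul_right_cancel₀ ha30
  rw [← pow_succ, Nat.sub_add_cancel hq, hNq, one_mul]
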